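/- Let A be a proper assignment set for a closed walk W in the brickwall 𝓑, suppose {0, y} ∈ A with n(y) = 0, and set W' = W_{0,y} ∘ H_{y,0} and A' = A \ {{0,y}}. Then for every elementary cycle C' of (W', A') there is an elementary cycle C of (W, A) such that C is a rotation of C'. -/

import Mathlib

open scoped Classical

namespace Hex

/-- Adjacency in the brickwall `𝓑`: vertex `(i,j)` is `b_{i,j}`.
Horizontal edges `b_{i,j} b_{i+1,j}` for all `i,j`, and vertical edges
`b_{i,j} b_{i+1,j+1}` for odd `i`. -/
def bwAdj (u v : ℤ × ℤ) : Prop :=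
  (u.2 = v.2 ∧ (v.1 = u.1 + 1 ∨ u.1 = v.1 + 1)) ∨
  (Odd u.1 ∧ v.1 = u.1 + 1 ∧ v.2 = u.2 + 1) ∨
  (Odd v.1 ∧ u.1 = v.1 + 1 ∧ u.2 = v.2 + 1)

/-- A closed walk of length `k` in the brickwall, represented by a `k`-periodic
function `f : ℤ → ℤ × ℤ` (so `W_i = f i`), with adjacency and no turning back. -/
def IsClosedWalk (k : ℕ) (f : ℤ → ℤ × ℤ) : Prop :=
  0 < k ∧ (∀ i : ℤ, f (i + (k : ℤ)) = f i) ∧ (∀ i : ℤ, bwAdj (f i) (f (i + 1))) ∧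
    (∀ i : ℤ, f (i - 1) ≠ f (i + 1))

/-- The neighbor of `v` immediately following `u` in the clockwise order
around `v` in the planar drawing of the brickwall:
around `b_{i,j}` with `i` odd the clockwise order is
`(b_{i+1,j+1}, b_{i+1,j}, b_{i-1,j})`, and with `i` even it is
`(b_{i+1,j}, b_{i-1,j-1}, b_{i-1,j})`. -/
def cwNext (v u : ℤ × ℤ) : ℤ × ℤ :=
  if v.1 % 2 = 0 then
    (if u = (v.1 + 1, v.2) then (v.1 - 1, v.2 - 1)
     else if u = (v.1 - 1, v.2 - 1) then (v.1 - 1, v.2)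
     else (v.1 + 1, v.2))
  else
    (if u = (v.1 + 1, v.2 + 1) then (v.1 + 1, v.2)
     else if u = (v.1 + 1, v.2) then (v.1 - 1, v.2)
     else (v.1 + 1, v.2 + 1))

/-- `W` makes a right turn at `i`: `W_{i-1}` immediately follows `W_{i+1}` clockwise. -/
def RightTurn (f : ℤ → ℤ × ℤ) (i : ℤ) : Prop := f (i - 1) = cwNext (f i) (f (i + 1))

/-- `W` makes a left turn at `i`: `W_{i+1}` immediately follows `W_{i-1}` clockwise. -/
def LeftTurn (f : ℤ → ℤ × ℤ) (i : ℤ) : Prop := f (i + 1) = cwNext (f i) (f (i - 1))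

noncomputable def rightCount (k : ℕ) (f : ℤ → ℤ × ℤ) : ℕ :=
  ((Finset.range k).filter fun t => RightTurn f (t : ℤ)).card

noncomputable def leftCount (k : ℕ) (f : ℤ → ℤ × ℤ) : ℕ :=
  ((Finset.range k).filter fun t => LeftTurn f (t : ℤ)).card

/-- The turning number `t(W) = (Right(W) - Left(W))/6`. -/
noncomputable def turningNumber (k : ℕ) (f : ℤ → ℤ × ℤ) : ℚ :=
  ((rightCount k f : ℚ) - (leftCount k f : ℚ)) / 6

/-- `uv` is a horizontal right edge: same height, smaller first coordinate even. -/
def HorizRight (u v : ℤ × ℤ) : Prop := u.2 = v.2 ∧ Even (min u.1 v.1)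

/-- `uv` is a horizontal left edge: same height, smaller first coordinate odd. -/
def HorizLeft (u v : ℤ × ℤ) : Prop := u.2 = v.2 ∧ Odd (min u.1 v.1)

/-- A right-turn walk: every vertical edge is immediately followed by a horizontal
right edge and immediately preceded by a horizontal left edge. -/
def IsRightTurnWalk (f : ℤ → ℤ × ℤ) : Prop :=
  ∀ i : ℤ, (f i).2 ≠ (f (i + 1)).2 →
    HorizRight (f (i + 1)) (f (i + 2)) ∧ HorizLeft (f (i - 1)) (f i)

/-- The unique neighbor of `W_i` other than `W_{i-1}` and `W_{i+1}`. -/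
def thirdNb (f : ℤ → ℤ × ℤ) (i : ℤ) : ℤ × ℤ :=
  if cwNext (f i) (f (i + 1)) = f (i - 1) then cwNext (f i) (f (i - 1))
  else cwNext (f i) (f (i + 1))

/-- `i ∈ {0,…,k-1}` is a PA-index: `W` makes a left turn at `i` and the third
neighbor of `W_i` has the same height as `W_i`. -/
def IsPAIndex (k : ℕ) (f : ℤ → ℤ × ℤ) (i : ℤ) : Prop :=
  0 ≤ i ∧ i < (k : ℤ) ∧ LeftTurn f i ∧ (thirdNb f i).2 = (f i).2

/-- The horizontal path in the brickwall from `u` to `v` (same height), as a list. -/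
def horizPath (u v : ℤ × ℤ) : List (ℤ × ℤ) :=
  if u.1 ≤ v.1 then (List.range ((v.1 - u.1).toNat + 1)).map fun t => (u.1 + (t : ℤ), u.2)
  else (List.range ((u.1 - v.1).toNat + 1)).map fun t => (u.1 - (t : ℤ), u.2)

/-- `p = {x,y}` is a possible assignment (PA) of the closed walk. -/
def IsPA (k : ℕ) (f : ℤ → ℤ × ℤ) (p : Finset ℤ) : Prop :=
  ∃ x y : ℤ, p = {x, y} ∧ IsPAIndex k f x ∧ IsPAIndex k f y ∧
    f x ≠ f y ∧ (f x).2 = (f y).2 ∧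
    ∀ z ∈ horizPath (f x) (f y),
      z ≠ f (x - 1) ∧ z ≠ f (x + 1) ∧ z ≠ f (y - 1) ∧ z ≠ f (y + 1)

/-- A proper assignment set: a set of PAs forming a non-crossing perfect matching
on the PA-indices. -/
def IsProperAssignment (k : ℕ) (f : ℤ → ℤ × ℤ) (A : Set (Finset ℤ)) : Prop :=
  (∀ p ∈ A, IsPA k f p) ∧
  (∀ i : ℤ, IsPAIndex k f i → ∃! p, p ∈ A ∧ i ∈ p) ∧
  (∀ p ∈ A, ∀ q ∈ A, ∀ i ∈ p, ∀ j ∈ p, ∀ x ∈ q, ∀ y ∈ q, ¬(i < x ∧ x < j ∧ j < y))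

/-- `n(i)`: the first PA-index strictly after `i` in cyclic order
(minimizing the cyclic distance `((j - i - 1) mod k) + 1`). -/
noncomputable def nextPA (k : ℕ) (f : ℤ → ℤ × ℤ) (i : ℤ) : ℤ :=
  if h : ∃ j : ℤ, IsPAIndex k f j ∧ ∀ j' : ℤ, IsPAIndex k f j' →
      (j - i - 1) % (k : ℤ) ≤ (j' - i - 1) % (k : ℤ)
  then h.choose else 0

/-- The subwalk `W_{x,y}` of the closed walk, as a list of `((y-x) mod k) + 1` vertices. -/
def subwalkList (k : ℕ) (f : ℤ → ℤ × ℤ) (x y : ℤ) : List (ℤ × ℤ) :=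
  (List.range (((y - x) % (k : ℤ)).toNat + 1)).map fun t => f (x + (t : ℤ))

/-- The cyclic function `ℤ → ℤ × ℤ` determined by a list of vertices. -/
def listFun (L : List (ℤ × ℤ)) : ℤ → ℤ × ℤ :=
  fun z => L.getD ((z % (L.length : ℤ)).toNat) (0, 0)

/-- An elementary cycle of `(W, A)`, given by its index sequence
`i_0, …, i_l` of PA-indices with `{n(i_t), i_{t+1}} ∈ A`, `{n(i_l), i_0} ∈ A`,
and canonical rotation `i_0 < i_t` for `t ≥ 1`. -/
structure ElemCycle (k : ℕ) (f : ℤ → ℤ × ℤ) (A : Set (Finset ℤ)) where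
  l : ℕ
  idx : ℕ → ℤ
  pa : ∀ t : ℕ, t ≤ l → IsPAIndex k f (idx t)
  mem : ∀ t : ℕ, t < l → ({nextPA k f (idx t), idx (t + 1)} : Finset ℤ) ∈ A
  memLast : ({nextPA k f (idx l), idx 0} : Finset ℤ) ∈ A
  minimal : ∀ t : ℕ, 1 ≤ t → t ≤ l → idx 0 < idx t
  canon : ∀ t : ℕ, l < t → idx t = idx 0

/-- The `t`-th segment `W_{i_t, n(i_t)} ∘ H_{n(i_t), i_{t+1}}` of an elementary
cycle (with final vertex dropped, for concatenation). -/
noncomputable def ecSegment {k : ℕ} {f : ℤ → ℤ × ℤ} {A : Set (Finset ℤ)}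
    (E : ElemCycle k f A) (t : ℕ) : List (ℤ × ℤ) :=
  (subwalkList k f (E.idx t) (nextPA k f (E.idx t))).dropLast ++
  (horizPath (f (nextPA k f (E.idx t))) (f (E.idx (if t = E.l then 0 else t + 1)))).dropLast

/-- The closed walk `C = W_{i_0,n(i_0)} ∘ H_{n(i_0),i_1} ∘ ⋯ ∘ H_{n(i_l),i_0}` of an
elementary cycle, as a list (without the repeated final vertex). -/
noncomputable def ecOpenList {k : ℕ} {f : ℤ → ℤ × ℤ} {A : Set (Finset ℤ)}
    (E : ElemCycle k f A) : List (ℤ × ℤ) :=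
  (List.range (E.l + 1)).flatMap (ecSegment E)

/-- The length of the closed walk of an elementary cycle. -/
noncomputable def ecLen {k : ℕ} {f : ℤ → ℤ × ℤ} {A : Set (Finset ℤ)}
    (E : ElemCycle k f A) : ℕ := (ecOpenList E).length

/-- The closed walk of an elementary cycle, as a periodic function. -/
noncomputable def ecFun {k : ℕ} {f : ℤ → ℤ × ℤ} {A : Set (Finset ℤ)}
    (E : ElemCycle k f A) : ℤ → ℤ × ℤ := listFun (ecOpenList E)

/-- `(m, g)` is (the closed walk of) an elementary cycle of `(W, A)`; if `A = ∅`
and `W` has no PA-index, `W` itself is the unique elementary cycle. -/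
def IsElemCycleWalk (k : ℕ) (f : ℤ → ℤ × ℤ) (A : Set (Finset ℤ))
    (m : ℕ) (g : ℤ → ℤ × ℤ) : Prop :=
  (∃ E : ElemCycle k f A, m = ecLen E ∧ g = ecFun E) ∨
  (A = ∅ ∧ (∀ i : ℤ, ¬ IsPAIndex k f i) ∧ m = k ∧ g = f)

/-- The number of elementary cycles of `(W, A)` (elementary cycles being
identified with their index sequences). -/
noncomputable def numElemCycles (k : ℕ) (f : ℤ → ℤ × ℤ) (A : Set (Finset ℤ)) : ℕ :=
  if A = ∅ ∧ ∀ i : ℤ, ¬ IsPAIndex k f i then 1 else Nat.card (ElemCycle k f A)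

/-- The number of PA-indices of the closed walk. -/
noncomputable def paCount (k : ℕ) (f : ℤ → ℤ × ℤ) : ℕ :=
  Nat.card {i : ℤ // IsPAIndex k f i}

/-- The walk `W' = W_{0,y} ∘ H_{y,0}`, as a list (without repeated final vertex). -/
noncomputable def splitList (k : ℕ) (f : ℤ → ℤ × ℤ) (y : ℤ) : List (ℤ × ℤ) :=
  (subwalkList k f 0 y).dropLast ++ (horizPath (f y) (f 0)).dropLast

/-- The length of the walk `W' = W_{0,y} ∘ H_{y,0}`. -/
noncomputable def splitLen (k : ℕ) (f : ℤ → ℤ × ℤ) (y : ℤ) : ℕ := (splitList k f y).length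

/-- The walk `W' = W_{0,y} ∘ H_{y,0}`, as a periodic function. -/
noncomputable def splitFun (k : ℕ) (f : ℤ → ℤ × ℤ) (y : ℤ) : ℤ → ℤ × ℤ :=
  listFun (splitList k f y)

/-- `Σ_{C ∈ 𝒞} (t(C) - 1)` over the set `𝒞` of elementary cycles of `(W, A)`. -/
noncomputable def elemTurnSum (k : ℕ) (f : ℤ → ℤ × ℤ) (A : Set (Finset ℤ)) : ℚ :=
  if A = ∅ ∧ ∀ i : ℤ, ¬ IsPAIndex k f i then turningNumber k f - 1
  else ∑ᶠ E : ElemCycle k f A, (turningNumber (ecLen E) (ecFun E) - 1)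

theorem cwNext_injOn_adj {v a c : ℤ × ℤ} (ha : bwAdj v a) (hc : bwAdj v c)
    (h : cwNext v a = cwNext v c) : a = c := by
  obtain ⟨v1, v2⟩ := v
  obtain ⟨a1, a2⟩ := a
  obtain ⟨c1, c2⟩ := c
  simp only [bwAdj, cwNext, Int.odd_iff, Prod.mk.injEq] at *
  split_ifs at h <;> simp only [Prod.mk.injEq] at h <;> omega

theorem bwAdj_symm {u v : ℤ × ℤ} (h : bwAdj u v) : bwAdj v u := by
  simp only [bwAdj, Int.odd_iff] at *
  omega

/-- A walk going straight along a row has its third neighbor on another row. -/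
theorem thirdNb_height_ne {f : ℤ → ℤ × ℤ} {i a b ε : ℤ} (hε : ε = 1 ∨ ε = -1)
    (h0 : f i = (a, b)) (hp : f (i - 1) = (a - ε, b)) (hn : f (i + 1) = (a + ε, b)) :
    (thirdNb f i).2 ≠ (f i).2 := by
  unfold thirdNb
  rw [h0, hp, hn]
  rcases hε with rfl | rfl <;> by_cases ha : a % 2 = 0 <;> simp [cwNext, ha] <;>
    split_ifs <;> simp <;> omega

/-- The coercion of a list of naturals to a list of integers is a map. -/
theorem map_coe_list {α : Type*} (L : List ℕ) (h : ℤ → α) :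
    (L >>= fun a => pure (a : ℤ)).map h = L.map fun t : ℕ => h t := by
  induction L with
  | nil => rfl
  | cons a L ih => simp_all

theorem horizPath_eq (u v : ℤ × ℤ) : horizPath u v =
    if u.1 ≤ v.1 then
      (List.range ((v.1 - u.1).toNat + 1)).map fun t : ℕ => (u.1 + (t : ℤ), u.2)
    else (List.range ((u.1 - v.1).toNat + 1)).map fun t : ℕ => (u.1 - (t : ℤ), u.2) := by
  unfold horizPath
  rw [map_coe_list, map_coe_list]

theorem subwalkList_eq (k : ℕ) (f : ℤ → ℤ × ℤ) (x y : ℤ) : subwalkList k f x y =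
    (List.range (((y - x) % (k : ℤ)).toNat + 1)).map fun t : ℕ => f (x + (t : ℤ)) :=
  map_coe_list _ _

theorem mem_horizPath {u v z : ℤ × ℤ} (h2 : z.2 = u.2) (hl : min u.1 v.1 ≤ z.1)
    (hr : z.1 ≤ max u.1 v.1) : z ∈ horizPath u v := by
  obtain ⟨z1, z2⟩ := z
  simp only at h2 hl hr
  rw [horizPath_eq]
  split_ifs with h
  · refine List.mem_map.2 ⟨(z1 - u.1).toNat, ?_, ?_⟩
    · rw [List.mem_range]; omega
    · rw [h2, Prod.mk.injEq]; omega
  · refine List.mem_map.2 ⟨(u.1 - z1).toNat, ?_, ?_⟩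
    · rw [List.mem_range]; omega
    · rw [h2, Prod.mk.injEq]; omega

theorem dropLast_map_range_succ {α : Type*} (n : ℕ) (h : ℕ → α) :
    ((List.range (n + 1)).map h).dropLast = (List.range n).map h := by
  simp [List.range_succ]

theorem horizPath_dropLast {u v : ℤ × ℤ} (h : u.1 ≠ v.1) :
    ∃ (ε : ℤ) (d : ℕ), (ε = 1 ∨ ε = -1) ∧ 0 < d ∧ v.1 = u.1 + ε * d ∧
      (horizPath u v).dropLast = (List.range d).map fun t : ℕ => (u.1 + ε * (t : ℤ), u.2) := by
  by_cases huv : u.1 ≤ v.1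
  · refine ⟨1, (v.1 - u.1).toNat, Or.inl rfl, by omega, by omega, ?_⟩
    simp only [horizPath_eq, if_pos huv, dropLast_map_range_succ, one_mul]
  · refine ⟨-1, (u.1 - v.1).toNat, Or.inr rfl, by omega, by omega, ?_⟩
    simp only [horizPath_eq, if_neg huv, dropLast_map_range_succ, neg_one_mul, ← sub_eq_add_neg]

theorem subwalkList_dropLast (k : ℕ) (f : ℤ → ℤ × ℤ) (x y : ℤ) :
    (subwalkList k f x y).dropLast =
      (List.range ((y - x) % (k : ℤ)).toNat).map fun t : ℕ => f (x + (t : ℤ)) := by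
  rw [subwalkList_eq, dropLast_map_range_succ]

theorem listFun_add_length (L : List (ℤ × ℤ)) (i : ℤ) :
    listFun L (i + L.length) = listFun L i := by
  simp [listFun]

theorem listFun_of_lt {L : List (ℤ × ℤ)} {n : ℕ} (h : n < L.length) :
    listFun L n = L[n] := by
  have : ((n : ℤ) % (L.length : ℤ)).toNat = n := by
    rw [Int.emod_eq_of_lt (by omega) (by omega)]; simp
  unfold listFun
  rw [this, List.getD_eq_getElem _ _ h]

theorem listFun_isRotated {L L' : List (ℤ × ℤ)} (h : L ~r L') :
    ∃ s : ℤ, ∀ t : ℤ, listFun L' t = listFun L (t + s) := by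
  obtain ⟨n, rfl⟩ := h
  refine ⟨n, fun t => ?_⟩
  unfold listFun
  rcases Nat.eq_zero_or_pos L.length with h0 | h0
  · rw [List.length_eq_zero_iff] at h0; subst h0; simp
  · have hL : (0 : ℤ) < L.length := by exact_mod_cast h0
    have h1 := Int.emod_nonneg t hL.ne'
    have h2 := Int.emod_lt_of_pos t hL
    have h3 := Int.emod_nonneg (t + n) hL.ne'
    have h4 := Int.emod_lt_of_pos (t + n) hL
    rw [List.length_rotate, List.getD_eq_getElem _ _ (by rw [List.length_rotate]; omega),
      List.getD_eq_getElem _ _ (by omega), List.getElem_rotate]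
    congr 1
    zify
    rw [Int.toNat_of_nonneg h1, Int.toNat_of_nonneg h3, Int.emod_add_emod]

theorem isRotated_flatMap {α β : Type*} {L L' : List α} (h : L ~r L') (g : α → List β) :
    L.flatMap g ~r L'.flatMap g := by
  obtain ⟨n, hn, rfl⟩ := List.isRotated_iff_mod.1 h
  rw [List.rotate_eq_drop_append_take hn, List.flatMap_append]
  conv_lhs => rw [← List.take_append_drop n L, List.flatMap_append]
  exact List.isRotated_append

theorem isRotated_range_shift (l T : ℕ) :
    List.range (l + 1) ~r (List.range (l + 1)).map fun s => (s + (T + 1)) % (l + 1) := by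
  refine ⟨T + 1, List.ext_getElem (by simp) fun i _ _ => ?_⟩
  simp [List.getElem_rotate]

theorem emod_sub_one_cases {k : ℕ} {i j : ℤ} (hi : 0 ≤ i) (hik : i < k) (hj : 0 ≤ j)
    (hjk : j < k) :
    (i < j ∧ (j - i - 1) % (k : ℤ) = j - i - 1) ∨
      (j ≤ i ∧ (j - i - 1) % (k : ℤ) = j - i - 1 + k) := by
  rcases lt_or_ge i j with h | h
  · exact Or.inl ⟨h, Int.emod_eq_of_lt (by omega) (by omega)⟩
  · refine Or.inr ⟨h, ?_⟩
    rw [← Int.add_emod_right, Int.emod_eq_of_lt (by omega) (by omega)]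

section NextPA

variable {k : ℕ} {f : ℤ → ℤ × ℤ} {i j : ℤ}

theorem nextPA_spec (hj : IsPAIndex k f j) :
    IsPAIndex k f (nextPA k f i) ∧ ∀ j' : ℤ, IsPAIndex k f j' →
      (nextPA k f i - i - 1) % (k : ℤ) ≤ (j' - i - 1) % (k : ℤ) := by
  have hfin : {x : ℤ | IsPAIndex k f x}.Finite :=
    (Set.finite_Ico (0 : ℤ) k).subset fun x hx => ⟨hx.1, hx.2.1⟩
  have hex : ∃ j : ℤ, IsPAIndex k f j ∧ ∀ j' : ℤ, IsPAIndex k f j' →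
      (j - i - 1) % (k : ℤ) ≤ (j' - i - 1) % (k : ℤ) := by
    obtain ⟨a, ha, hmin⟩ :=
      Set.exists_min_image _ (fun x : ℤ => (x - i - 1) % (k : ℤ)) hfin ⟨j, hj⟩
    exact ⟨a, ha, hmin⟩
  unfold nextPA
  rw [dif_pos hex]
  exact hex.choose_spec

/-- `n(i)` in terms of the linear order of the indices. -/
theorem nextPA_cases (hi : IsPAIndex k f i) :
    IsPAIndex k f (nextPA k f i) ∧
      ((i < nextPA k f i ∧ ∀ j, IsPAIndex k f j → i < j → nextPA k f i ≤ j) ∨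
        ((∀ j, IsPAIndex k f j → j ≤ i) ∧ ∀ j, IsPAIndex k f j → nextPA k f i ≤ j)) := by
  obtain ⟨hn, hmin⟩ := nextPA_spec (i := i) hi
  refine ⟨hn, ?_⟩
  rcases emod_sub_one_cases hi.1 hi.2.1 hn.1 hn.2.1 with ⟨h, e⟩ | ⟨h, e⟩
  · refine Or.inl ⟨h, fun j hj hij => ?_⟩
    have := hmin j hj
    have hj1 := hj.1
    rcases emod_sub_one_cases hi.1 hi.2.1 hj.1 hj.2.1 with ⟨h', e'⟩ | ⟨h', e'⟩ <;> omega
  · have hn1 := hn.1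
    refine Or.inr ⟨fun j hj => ?_, fun j hj => ?_⟩ <;>
    · have := hmin j hj
      have hj1 := hj.2.1
      rcases emod_sub_one_cases hi.1 hi.2.1 hj.1 hj.2.1 with ⟨h', e'⟩ | ⟨h', e'⟩ <;> omega

theorem nextPA_eq_of_lt (hi : IsPAIndex k f i) (hj : IsPAIndex k f j) (hij : i < j)
    (hmin : ∀ j', IsPAIndex k f j' → i < j' → j ≤ j') : nextPA k f i = j := by
  obtain ⟨hn, ⟨h1, h2⟩ | ⟨h1, h2⟩⟩ := nextPA_cases hi
  · exact le_antisymm (h2 j hj hij) (hmin _ hn h1)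
  · exact absurd (h1 j hj) (not_le.2 hij)

end NextPA

theorem IsPA.card_eq_two {k : ℕ} {f : ℤ → ℤ × ℤ} {p : Finset ℤ} (h : IsPA k f p) :
    p.card = 2 := by
  obtain ⟨x, y, rfl, -, -, hxy, -⟩ := h
  exact Finset.card_pair fun e => hxy (congrArg f e)

theorem IsPA.isPAIndex {k : ℕ} {f : ℤ → ℤ × ℤ} {p : Finset ℤ} (h : IsPA k f p) {i : ℤ}
    (hi : i ∈ p) : IsPAIndex k f i := by
  obtain ⟨x, y, rfl, hx, hy, -⟩ := h
  rcases Finset.mem_insert.1 hi with rfl | hi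
  · exact hx
  · rwa [Finset.mem_singleton.1 hi]

theorem ne_of_card_pair {a b : ℤ} (h : ({a, b} : Finset ℤ).card = 2) : a ≠ b := by
  rintro rfl
  simp at h

/-- Both orders of the pair `{x, y}` satisfy the conditions of a possible assignment. -/
theorem IsPA.pair_spec {k : ℕ} {f : ℤ → ℤ × ℤ} {x y : ℤ} (h : IsPA k f {x, y}) :
    f x ≠ f y ∧ (f x).2 = (f y).2 ∧ ∀ z : ℤ × ℤ, z.2 = (f x).2 →
      min (f x).1 (f y).1 ≤ z.1 → z.1 ≤ max (f x).1 (f y).1 →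
      z ≠ f (x - 1) ∧ z ≠ f (x + 1) ∧ z ≠ f (y - 1) ∧ z ≠ f (y + 1) := by
  obtain ⟨a, b, hab, -, -, hne, h2, hz⟩ := h
  have hset : (({x, y} : Finset ℤ) : Set ℤ) = ({a, b} : Finset ℤ) := by rw [hab]
  simp only [Finset.coe_pair] at hset
  rcases Set.pair_eq_pair_iff.1 hset with ⟨rfl, rfl⟩ | ⟨rfl, rfl⟩
  · exact ⟨hne, h2, fun z h h' h'' => hz z (mem_horizPath h h' h'')⟩
  · refine ⟨hne.symm, h2.symm, fun z h h' h'' => ?_⟩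
    have := hz z (mem_horizPath (h.trans h2.symm) (by rwa [min_comm]) (by rwa [max_comm]))
    tauto

theorem IsProperAssignment.partner_unique {k : ℕ} {f : ℤ → ℤ × ℤ} {A : Set (Finset ℤ)}
    (hA : IsProperAssignment k f A) {p a b : ℤ} (ha : ({p, a} : Finset ℤ) ∈ A)
    (hb : ({p, b} : Finset ℤ) ∈ A) : a = b := by
  have hp : IsPAIndex k f p := (hA.1 _ ha).isPAIndex (by simp)
  have he : ({p, a} : Finset ℤ) = {p, b} :=
    (hA.2.1 p hp).unique ⟨ha, by simp⟩ ⟨hb, by simp⟩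
  have hne := ne_of_card_pair (hA.1 _ ha).card_eq_two
  have : a ∈ ({p, b} : Finset ℤ) := he ▸ (by simp)
  simp only [Finset.mem_insert, Finset.mem_singleton] at this
  exact this.resolve_left hne.symm

section ElemCycle

variable {k : ℕ} {f : ℤ → ℤ × ℤ} {A : Set (Finset ℤ)}

/-- The segment `W_{i,n(i)} ∘ H_{n(i),j}` with its final vertex dropped. -/
noncomputable def segmentList (k : ℕ) (f : ℤ → ℤ × ℤ) (i j : ℤ) : List (ℤ × ℤ) :=
  (subwalkList k f i (nextPA k f i)).dropLast ++
    (horizPath (f (nextPA k f i)) (f j)).dropLast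

theorem ElemCycle.idx_succ_mod (E : ElemCycle k f A) {t : ℕ} (ht : t ≤ E.l) :
    E.idx (if t = E.l then 0 else t + 1) = E.idx ((t + 1) % (E.l + 1)) := by
  split_ifs with h
  · rw [h, Nat.mod_self]
  · rw [Nat.mod_eq_of_lt (by omega)]

theorem ElemCycle.ecSegment_eq (E : ElemCycle k f A) {t : ℕ} (ht : t ≤ E.l) :
    ecSegment E t = segmentList k f (E.idx t) (E.idx ((t + 1) % (E.l + 1))) := by
  unfold ecSegment segmentList
  rw [E.idx_succ_mod ht]

theorem ElemCycle.mem_mod (E : ElemCycle k f A) {t : ℕ} (ht : t ≤ E.l) :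
    ({nextPA k f (E.idx t), E.idx ((t + 1) % (E.l + 1))} : Finset ℤ) ∈ A := by
  rcases ht.lt_or_eq with h | h
  · rw [Nat.mod_eq_of_lt (by omega)]; exact E.mem t h
  · rw [h, Nat.mod_self]; exact E.memLast

/-- The indices of an elementary cycle are distinct if each index has a unique partner. -/
theorem ElemCycle.idx_injOn (E : ElemCycle k f A)
    (hA : ∀ p a b : ℤ, ({p, a} : Finset ℤ) ∈ A → ({p, b} : Finset ℤ) ∈ A → a = b)
    {s t : ℕ} (hst : s < t) (ht : t ≤ E.l) : E.idx s ≠ E.idx t := by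
  intro h
  have key : ∀ j, E.idx ((s + j) % (E.l + 1)) = E.idx ((t + j) % (E.l + 1)) := by
    intro j
    induction j with
    | zero => simpa [Nat.mod_eq_of_lt (show s < E.l + 1 by omega),
        Nat.mod_eq_of_lt (show t < E.l + 1 by omega)] using h
    | succ j ih =>
      have h1 := E.mem_mod (t := (s + j) % (E.l + 1))
        (Nat.le_of_lt_succ (Nat.mod_lt _ (Nat.succ_pos _)))
      have h2 := E.mem_mod (t := (t + j) % (E.l + 1))
        (Nat.le_of_lt_succ (Nat.mod_lt _ (Nat.succ_pos _)))
      rw [← ih] at h2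
      simpa [Nat.add_assoc] using hA _ _ _ h1 h2
  have h0 := key (E.l + 1 - t)
  rw [show t + (E.l + 1 - t) = E.l + 1 by omega, Nat.mod_self,
    Nat.mod_eq_of_lt (by omega)] at h0
  have := E.minimal (s + (E.l + 1 - t)) (by omega) (by omega)
  omega

end ElemCycle

/-- `(k', f')` is the closed walk following `f` from `0` to `y` and then the row of `f y`
for `d` steps in direction `ε`, back to `f 0`. -/
structure IsSplit (f : ℤ → ℤ × ℤ) (y : ℤ) (k' : ℕ) (f' : ℤ → ℤ × ℤ) (ε : ℤ) (d : ℕ) :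
    Prop where
  dir : ε = 1 ∨ ε = -1
  pos : 0 < d
  len : (k' : ℤ) = y + d
  closes : f 0 = ((f y).1 + ε * d, (f y).2)
  horiz : (horizPath (f y) (f 0)).dropLast =
    (List.range d).map fun t : ℕ => ((f y).1 + ε * (t : ℤ), (f y).2)
  eq_walk : ∀ i, 0 ≤ i → i ≤ y → f' i = f i
  eq_row : ∀ s, 0 ≤ s → s ≤ (d : ℤ) → f' (y + s) = ((f y).1 + ε * s, (f y).2)
  periodic : ∀ i, f' (i + k') = f' i

theorem isSplit_splitFun {k : ℕ} {f : ℤ → ℤ × ℤ} {y : ℤ} (hy0 : 0 < y) (hyk : y < k)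
    (hne : f 0 ≠ f y) (h2 : (f 0).2 = (f y).2) :
    ∃ ε d, IsSplit f y (splitLen k f y) (splitFun k f y) ε d := by
  have h1 : (f y).1 ≠ (f 0).1 := fun h => hne (Prod.ext h.symm h2)
  obtain ⟨ε, d, hε, hd, hcl, hpath⟩ := horizPath_dropLast h1
  have hmod : ((y - 0) % (k : ℤ)).toNat = y.toNat := by
    rw [sub_zero, Int.emod_eq_of_lt hy0.le hyk]
  have hL : splitList k f y = ((List.range y.toNat).map fun t : ℕ => f (0 + (t : ℤ))) ++
      (List.range d).map fun t : ℕ => ((f y).1 + ε * (t : ℤ), (f y).2) := by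
    unfold splitList
    rw [subwalkList_dropLast, hmod, hpath]
  have hlen : (splitList k f y).length = y.toNat + d := by rw [hL]; simp
  have hper : ∀ i, splitFun k f y (i + splitLen k f y) = splitFun k f y i :=
    listFun_add_length _
  have hwalk : ∀ i, 0 ≤ i → i < y → splitFun k f y i = f i := by
    intro i hi hiy
    lift i to ℕ using hi
    unfold splitFun
    rw [listFun_of_lt (by omega)]
    simp only [hL]
    rw [List.getElem_append_left (by simp; omega)]
    simp
  have hcl' : f 0 = ((f y).1 + ε * d, (f y).2) := Prod.ext hcl h2
  have hrow : ∀ s, 0 ≤ s → s ≤ (d : ℤ) →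
      splitFun k f y (y + s) = ((f y).1 + ε * s, (f y).2) := by
    intro s hs hsd
    rcases hsd.lt_or_eq with hlt | rfl
    · lift s to ℕ using hs
      unfold splitFun
      rw [show y + (s : ℤ) = ((y.toNat + s : ℕ) : ℤ) by omega, listFun_of_lt (by omega)]
      simp only [hL]
      rw [List.getElem_append_right (by simp)]
      simp
    · rw [← hcl', ← hwalk 0 le_rfl hy0, ← hper 0, splitLen, hlen]
      congr 1
      omega
  refine ⟨ε, d, hε, hd, by rw [splitLen, hlen]; omega, hcl', hpath, fun i hi hiy => ?_, hrow, hper⟩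
  rcases hiy.lt_or_eq with hlt | rfl
  · exact hwalk i hi hlt
  · simpa using hrow 0 le_rfl (by omega)

/-- Splitting at `{0, y}` removes exactly the PA-indices `0` and `y`. -/
theorem IsSplit.isPAIndex_iff {k k' d : ℕ} {f f' : ℤ → ℤ × ℤ} {y ε : ℤ}
    (hS : IsSplit f y k' f' ε d) (hW : IsClosedWalk k f) (hPA : IsPA k f {0, y})
    (hy0 : 0 < y) (hmax : ∀ j, IsPAIndex k f j → j ≤ y) (i : ℤ) :
    IsPAIndex k' f' i ↔ IsPAIndex k f i ∧ 0 < i ∧ i < y := by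
  have hyk : y < k := (hPA.isPAIndex (i := y) (by simp)).2.1
  have hleft : LeftTurn f 0 := (hPA.isPAIndex (i := 0) (by simp)).2.2.1
  have hlefty : LeftTurn f y := (hPA.isPAIndex (i := y) (by simp)).2.2.1
  obtain ⟨-, -, hz⟩ := hPA.pair_spec
  have hpos := hS.pos
  have hlen := hS.len
  have hcl1 : (f 0).1 = (f y).1 + ε * d := by rw [hS.closes]
  have hcl2 : (f 0).2 = (f y).2 := by rw [hS.closes]
  have hmid : 0 < i → i < y → f' (i - 1) = f (i - 1) ∧ f' i = f i ∧ f' (i + 1) = f (i + 1) :=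
    fun h0 hy => ⟨hS.eq_walk _ (by omega) (by omega), hS.eq_walk _ (by omega) (by omega),
      hS.eq_walk _ (by omega) (by omega)⟩
  constructor
  · rintro ⟨h0, hk, hl, ht⟩
    rcases lt_trichotomy i y with hiy | rfl | hiy
    · rcases h0.lt_or_eq with h0 | rfl
      · obtain ⟨e1, e2, e3⟩ := hmid h0 hiy
        refine ⟨⟨h0.le, by omega, ?_, ?_⟩, h0, hiy⟩
        · simpa only [LeftTurn, e1, e2, e3] using hl
        · simpa only [thirdNb, e1, e2, e3] using ht
      · exfalso
        have hprev : f' (0 - 1) = ((f y).1 + ε * (d - 1), (f y).2) := by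
          rw [← hS.periodic, ← hS.eq_row _ (by omega) (by omega)]
          congr 1
          omega
        unfold LeftTurn at hl hleft
        rw [hprev, hS.eq_walk 0 le_rfl hy0.le, hS.eq_walk _ (by omega) (by omega), hleft] at hl
        have hadj : bwAdj (f 0) ((f y).1 + ε * (d - 1), (f y).2) := by
          refine Or.inl ⟨hcl2, ?_⟩
          rcases hS.dir with rfl | rfl
          · right; simp only; omega
          · left; simp only; omega
        have hadj' : bwAdj (f 0) (f (0 - 1)) := bwAdj_symm (by simpa using hW.2.2.1 (0 - 1))
        refine (hz ((f y).1 + ε * (d - 1), (f y).2) hcl2.symm ?_ ?_).1 (cwNext_injOn_adj hadj' hadj hl).symm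
        all_goals rcases hS.dir with rfl | rfl <;> simp only <;> omega
    · exfalso
      unfold LeftTurn at hl hlefty
      rw [hS.eq_row 1 (by omega) (by omega), hS.eq_walk i h0 le_rfl,
        hS.eq_walk (i - 1) (by omega) (by omega), ← hlefty] at hl
      refine (hz ((f i).1 + ε * 1, (f i).2) hcl2.symm ?_ ?_).2.2.2 hl
      all_goals rcases hS.dir with rfl | rfl <;> simp only <;> omega
    · exfalso
      obtain ⟨s, rfl⟩ : ∃ s, i = y + s := ⟨i - y, by omega⟩
      refine thirdNb_height_ne hS.dir (hS.eq_row s (by omega) (by omega)) ?_ ?_ ht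
      · rw [show y + s - 1 = y + (s - 1) by omega, hS.eq_row _ (by omega) (by omega),
          Prod.mk.injEq]
        exact ⟨by ring, rfl⟩
      · rw [show y + s + 1 = y + (s + 1) by omega, hS.eq_row _ (by omega) (by omega),
          Prod.mk.injEq]
        exact ⟨by ring, rfl⟩
  · rintro ⟨⟨-, -, hl, ht⟩, h0, hiy⟩
    obtain ⟨e1, e2, e3⟩ := hmid h0 hiy
    refine ⟨h0.le, by omega, ?_, ?_⟩
    · simpa only [LeftTurn, e1, e2, e3] using hl
    · simpa only [thirdNb, e1, e2, e3] using ht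

theorem IsSplit.subwalkList_dropLast_eq {k k' d : ℕ} {f f' : ℤ → ℤ × ℤ} {y ε i j : ℤ}
    (hS : IsSplit f y k' f' ε d) (hyk : y < k) (hi : 0 ≤ i) (hij : i ≤ j) (hjy : j ≤ y) :
    (subwalkList k' f' i j).dropLast = (subwalkList k f i j).dropLast := by
  have hlen := hS.len
  have hpos := hS.pos
  rw [subwalkList_dropLast, subwalkList_dropLast, Int.emod_eq_of_lt (by omega) (by omega),
    Int.emod_eq_of_lt (by omega) (by omega)]
  refine List.map_congr_left fun t ht => hS.eq_walk _ (by omega) ?_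
  rw [List.mem_range] at ht
  omega

/-- The subwalk of the split walk that wraps around consists of `W_{j,y}`, `H_{y,0}`
and `W_{0,i}`. -/
theorem IsSplit.subwalkList_dropLast_wrap {k k' d : ℕ} {f f' : ℤ → ℤ × ℤ} {y ε i j : ℤ}
    (hS : IsSplit f y k' f' ε d) (hyk : y < k) (hi : 0 ≤ i) (hij : i < j) (hjy : j ≤ y) :
    (subwalkList k' f' j i).dropLast = (subwalkList k f j y).dropLast ++
      (horizPath (f y) (f 0)).dropLast ++ (subwalkList k f 0 i).dropLast := by
  have hlen := hS.len
  have hpos := hS.pos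
  have hmod : ((i - j) % (k' : ℤ)).toNat = (y - j).toNat + d + i.toNat := by
    rw [← Int.add_emod_right, Int.emod_eq_of_lt (by omega) (by omega)]
    omega
  simp only [subwalkList_dropLast, hS.horiz]
  rw [hmod, Int.emod_eq_of_lt (by omega) (by omega), Int.emod_eq_of_lt (by omega) (by omega),
    List.range_add, List.range_add, List.map_append, List.map_append, List.map_map, List.map_map,
    sub_zero]
  congr 1
  · congr 1
    · refine List.map_congr_left fun t ht => hS.eq_walk _ (by omega) ?_
      rw [List.mem_range] at ht
      omega
    · refine List.map_congr_left fun t ht => ?_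
      rw [List.mem_range] at ht
      rw [← hS.eq_row _ (by omega) (by omega)]
      simp only [Function.comp]
      congr 1
      omega
  · refine List.map_congr_left fun t ht => ?_
    rw [List.mem_range] at ht
    rw [← hS.eq_walk _ (by omega) (by omega), ← hS.periodic]
    simp only [Function.comp]
    congr 1
    omega

section Lift

variable {k k' d : ℕ} {f f' : ℤ → ℤ × ℤ} {A : Set (Finset ℤ)} {y ε : ℤ}

theorem nextPA_eq_of_not_max (hiff : ∀ i, IsPAIndex k' f' i ↔ IsPAIndex k f i ∧ 0 < i ∧ i < y)
    {i j : ℤ} (hi : IsPAIndex k' f' i) (hj : IsPAIndex k' f' j) (hij : i < j) :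
    nextPA k f i = nextPA k' f' i ∧ i < nextPA k' f' i ∧ nextPA k' f' i < y := by
  obtain ⟨hn, ⟨h1, h2⟩ | ⟨h1, h2⟩⟩ := nextPA_cases hi
  · have hn' := (hiff _).1 hn
    refine ⟨nextPA_eq_of_lt ((hiff _).1 hi).1 hn'.1 h1 fun j' hj' hij' => ?_, h1, hn'.2.2⟩
    by_contra hlt
    exact hlt (h2 j' ((hiff _).2 ⟨hj', by have := hi.1; omega, by omega⟩) hij')
  · exact absurd (h1 j hj) (not_le.2 hij)

theorem segmentList_eq_of_not_max (hS : IsSplit f y k' f' ε d) (hyk : y < k)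
    (hiff : ∀ i, IsPAIndex k' f' i ↔ IsPAIndex k f i ∧ 0 < i ∧ i < y)
    {i j a : ℤ} (hi : IsPAIndex k' f' i) (hj : IsPAIndex k' f' j) (hij : i < j)
    (ha : IsPAIndex k' f' a) : segmentList k f i a = segmentList k' f' i a := by
  obtain ⟨hn, h1, h2⟩ := nextPA_eq_of_not_max hiff hi hj hij
  have ha' := (hiff _).1 ha
  have hi0 := hi.1
  unfold segmentList
  rw [hn, hS.subwalkList_dropLast_eq hyk hi0 h1.le h2.le,
    hS.eq_walk _ (by omega) h2.le, hS.eq_walk _ ha.1 ha'.2.2.le]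

/-- An elementary cycle of the split walk that avoids the last PA-index is one of the
original walk. -/
theorem exists_elemCycle_eq (hS : IsSplit f y k' f' ε d) (hyk : y < k)
    (hiff : ∀ i, IsPAIndex k' f' i ↔ IsPAIndex k f i ∧ 0 < i ∧ i < y)
    (E : ElemCycle k' f' (A \ {({0, y} : Finset ℤ)}))
    (hM : ∀ T ≤ E.l, ∃ j, IsPAIndex k' f' j ∧ E.idx T < j) :
    ∃ E' : ElemCycle k f A, ecOpenList E' = ecOpenList E := by
  have hn : ∀ t ≤ E.l, nextPA k f (E.idx t) = nextPA k' f' (E.idx t) := fun t ht => by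
    obtain ⟨j, hj, hij⟩ := hM t ht
    exact (nextPA_eq_of_not_max hiff (E.pa t ht) hj hij).1
  let E' : ElemCycle k f A :=
    { l := E.l
      idx := E.idx
      pa := fun t ht => ((hiff _).1 (E.pa t ht)).1
      mem := fun t ht => by rw [hn t ht.le]; exact (E.mem t ht).1
      memLast := by rw [hn _ le_rfl]; exact E.memLast.1
      minimal := E.minimal
      canon := E.canon }
  refine ⟨E', List.flatMap_congr fun t ht => ?_⟩
  have ht' : t ≤ E.l := Nat.le_of_lt_succ (List.mem_range.1 ht)
  obtain ⟨j, hj, hij⟩ := hM t ht'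
  rw [E'.ecSegment_eq ht', E.ecSegment_eq ht']
  exact segmentList_eq_of_not_max hS hyk hiff (E.pa t ht') hj hij
    (E.pa _ (Nat.le_of_lt_succ (Nat.mod_lt _ (Nat.succ_pos _))))

/-- An elementary cycle of the split walk through the last PA-index becomes one of the
original walk, up to rotation, by inserting the index `0` after it. -/
theorem exists_elemCycle_isRotated (hS : IsSplit f y k' f' ε d)
    (hA : IsProperAssignment k f A) (hmem : ({0, y} : Finset ℤ) ∈ A) (hy0 : 0 < y)
    (hmax : ∀ j, IsPAIndex k f j → j ≤ y)
    (hiff : ∀ i, IsPAIndex k' f' i ↔ IsPAIndex k f i ∧ 0 < i ∧ i < y)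
    (E : ElemCycle k' f' (A \ {({0, y} : Finset ℤ)})) {T : ℕ} (hT : T ≤ E.l)
    (hTmax : ∀ j, IsPAIndex k' f' j → j ≤ E.idx T) :
    ∃ E' : ElemCycle k f A, ecOpenList E ~r ecOpenList E' := by
  have h0 : IsPAIndex k f 0 := (hA.1 _ hmem).isPAIndex (by simp)
  have hy : IsPAIndex k f y := (hA.1 _ hmem).isPAIndex (by simp)
  have hmod : ∀ s, s % (E.l + 1) ≤ E.l := fun s =>
    Nat.le_of_lt_succ (Nat.mod_lt _ (Nat.succ_pos _))
  have hpaT := E.pa T hT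
  have hT' := (hiff _).1 hpaT
  -- the last PA-index of the split walk is followed by `y` in the original walk
  have hnM : nextPA k f (E.idx T) = y := by
    refine nextPA_eq_of_lt hT'.1 hy hT'.2.2 fun j hj hij => ?_
    by_contra hlt
    exact absurd (hTmax j ((hiff _).2 ⟨hj, by omega, by omega⟩)) (not_le.2 hij)
  obtain ⟨hpam, hm⟩ : IsPAIndex k' f' (nextPA k' f' (E.idx T)) ∧
      ∀ j, IsPAIndex k' f' j → nextPA k' f' (E.idx T) ≤ j := by
    obtain ⟨hn, ⟨h1, -⟩ | ⟨-, h2⟩⟩ := nextPA_cases hpaT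
    · exact absurd (hTmax _ hn) (not_le.2 h1)
    · exact ⟨hn, h2⟩
  have hm' := (hiff _).1 hpam
  have hn0 : nextPA k f 0 = nextPA k' f' (E.idx T) := by
    refine nextPA_eq_of_lt h0 hm'.1 hm'.2.1 fun j hj hj0 => ?_
    rcases (hmax j hj).lt_or_eq with hlt | rfl
    · exact hm j ((hiff _).2 ⟨hj, hj0, hlt⟩)
    · exact hm'.2.2.le
  have hmT : nextPA k' f' (E.idx T) < E.idx T := by
    have hne := ne_of_card_pair (hA.1 _ (E.mem_mod hT).1).card_eq_two
    have hpa := E.pa _ (hmod (T + 1))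
    have h1 := hm _ hpa
    have h2 := hTmax _ hpa
    omega
  have hlt : ∀ t ≤ E.l, t ≠ T → E.idx t < E.idx T := by
    intro t ht htT
    refine lt_of_le_of_ne (hTmax _ (E.pa t ht)) ?_
    have hu : ∀ p a b : ℤ, ({p, a} : Finset ℤ) ∈ A \ {({0, y} : Finset ℤ)} →
        ({p, b} : Finset ℤ) ∈ A \ {({0, y} : Finset ℤ)} → a = b :=
      fun p a b ha hb => hA.partner_unique ha.1 hb.1
    rcases htT.lt_or_gt with h | h
    · exact E.idx_injOn hu h hT
    · exact (E.idx_injOn hu h ht).symm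
  have hneT : ∀ s, s < E.l → (s + (T + 1)) % (E.l + 1) ≠ T := by
    intro s hs h
    rcases lt_or_ge (s + (T + 1)) (E.l + 1) with h' | h'
    · rw [Nat.mod_eq_of_lt h'] at h; omega
    · rw [Nat.mod_eq_sub_mod h', Nat.mod_eq_of_lt (by omega)] at h; omega
  have hlast : (E.l + (T + 1)) % (E.l + 1) = T := by
    rw [show E.l + (T + 1) = T + (E.l + 1) by omega, Nat.add_mod_right,
      Nat.mod_eq_of_lt (by omega)]
  have hsucc : ∀ s, ((s + (T + 1)) % (E.l + 1) + 1) % (E.l + 1) =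
      (s + 1 + (T + 1)) % (E.l + 1) := by
    intro s
    rw [Nat.mod_add_mod]
    congr 1
    omega
  have hnext : ∀ s, s < E.l → nextPA k f (E.idx ((s + (T + 1)) % (E.l + 1))) =
      nextPA k' f' (E.idx ((s + (T + 1)) % (E.l + 1))) := fun s hs =>
    (nextPA_eq_of_not_max hiff (E.pa _ (hmod _)) hpaT (hlt _ (hmod _) (hneT s hs))).1
  let idx : ℕ → ℤ := fun s =>
    match s with
    | 0 => 0
    | s + 1 => if s ≤ E.l then E.idx ((s + (T + 1)) % (E.l + 1)) else 0
  have idx_succ : ∀ s, s ≤ E.l → idx (s + 1) = E.idx ((s + (T + 1)) % (E.l + 1)) :=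
    fun s hs => if_pos hs
  have idx_last : idx (E.l + 1) = E.idx T := by rw [idx_succ _ le_rfl, hlast]
  let E' : ElemCycle k f A :=
    { l := E.l + 1
      idx := idx
      pa := by
        rintro (_ | s) hs
        · exact h0
        · rw [idx_succ s (by omega)]
          exact ((hiff _).1 (E.pa _ (hmod _))).1
      mem := by
        rintro (_ | s) hs
        · rw [idx_succ 0 (by omega), Nat.zero_add]
          change ({nextPA k f 0, _} : Finset ℤ) ∈ A
          rw [hn0]
          exact (E.mem_mod hT).1
        · rw [idx_succ s (by omega), idx_succ (s + 1) (by omega), hnext s (by omega), ← hsucc s]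
          exact (E.mem_mod (hmod _)).1
      memLast := by
        rw [idx_last, hnM, Finset.pair_comm]
        exact hmem
      minimal := by
        rintro (_ | s) h1 hs
        · omega
        · rw [idx_succ s (by omega)]
          exact ((hiff _).1 (E.pa _ (hmod _))).2.1
      canon := by
        rintro (_ | s) hs
        · rfl
        · exact if_neg (by omega) }
  refine ⟨E', (isRotated_flatMap (isRotated_range_shift E.l T) _).trans ?_⟩
  set P := (subwalkList k f (E.idx T) y).dropLast ++ (horizPath (f y) (f 0)).dropLast with hP
  set Q := segmentList k f 0 (E.idx ((T + 1) % (E.l + 1))) with hQ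
  set R := (List.range E.l).flatMap fun s => ecSegment E ((s + (T + 1)) % (E.l + 1))
  have hsegT : ecSegment E T = P ++ Q := by
    rw [E.ecSegment_eq hT, segmentList, hS.subwalkList_dropLast_wrap hy.2.1 hpam.1 hmT
      hT'.2.2.le, hP, hQ, segmentList, hn0, hS.eq_walk _ hpam.1 hm'.2.2.le,
      hS.eq_walk _ (E.pa _ (hmod _)).1 ((hiff _).1 (E.pa _ (hmod _))).2.2.le]
    simp only [List.append_assoc]
  have hleft : ((List.range (E.l + 1)).map fun s => (s + (T + 1)) % (E.l + 1)).flatMap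
      (ecSegment E) = R ++ P ++ Q := by
    rw [List.flatMap_map, List.range_succ, List.flatMap_append, List.flatMap_singleton, hlast,
      hsegT, ← List.append_assoc]
  have hfirst : ecSegment E' 0 = Q := by
    rw [E'.ecSegment_eq (Nat.zero_le _), Nat.mod_eq_of_lt (by simp [E'])]
    change segmentList k f 0 (idx (0 + 1)) = Q
    rw [idx_succ 0 (Nat.zero_le _), Nat.zero_add]
  have hmidseg : ∀ s ∈ List.range E.l,
      ecSegment E' (s + 1) = ecSegment E ((s + (T + 1)) % (E.l + 1)) := by
    intro s hs
    rw [List.mem_range] at hs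
    rw [E'.ecSegment_eq (show s + 1 ≤ E.l + 1 by omega), E.ecSegment_eq (hmod _),
      Nat.mod_eq_of_lt (show s + 1 + 1 < E.l + 1 + 1 by omega)]
    change segmentList k f (idx (s + 1)) (idx (s + 1 + 1)) = _
    rw [idx_succ s hs.le, idx_succ (s + 1) hs, hsucc]
    exact segmentList_eq_of_not_max hS hy.2.1 hiff (E.pa _ (hmod _)) hpaT
      (hlt _ (hmod _) (hneT s hs)) (E.pa _ (hmod _))
  have hend : ecSegment E' (E.l + 1) = P := by
    rw [E'.ecSegment_eq le_rfl, show (E.l + 1 + 1) % (E'.l + 1) = 0 from Nat.mod_self _]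
    change segmentList k f (idx (E.l + 1)) 0 = P
    rw [idx_last, segmentList, hnM]
  have hright : ecOpenList E' = Q ++ (R ++ P) := by
    change (List.range (E.l + 1 + 1)).flatMap (ecSegment E') = _
    rw [List.range_succ, List.flatMap_append, List.flatMap_singleton, hend,
      List.range_succ_eq_map, List.flatMap_cons, hfirst, List.flatMap_map,
      List.flatMap_congr hmidseg, List.append_assoc]
  rw [hleft, hright]
  exact List.isRotated_append

end Lift

/-- Let `A` be a proper assignment set for a closed walk `W` in the
brickwall with `{0, y} ∈ A` and `n(y) = 0`, and let `W' = W_{0,y} ∘ H_{y,0}` and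
`A' = A \ {{0,y}}`. Then for every elementary cycle `C'` of `(W', A')` there is an
elementary cycle `C` of `(W, A)` such that `C` is a rotation of `C'`. -/
theorem split_elemCycle_has_rotation
    (k : ℕ) (f : ℤ → ℤ × ℤ) (A : Set (Finset ℤ)) (y : ℤ)
    (hW : IsClosedWalk k f) (hA : IsProperAssignment k f A)
    (hmem : ({0, y} : Finset ℤ) ∈ A) (hny : nextPA k f y = 0)
    (m : ℕ) (g : ℤ → ℤ × ℤ)
    (hC' : IsElemCycleWalk (splitLen k f y) (splitFun k f y)
      (A \ {({0, y} : Finset ℤ)}) m g) :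
    ∃ g' : ℤ → ℤ × ℤ, IsElemCycleWalk k f A m g' ∧
      ∃ s : ℤ, ∀ t : ℤ, g' t = g (t + s) := by
  have hPA := hA.1 _ hmem
  have h0 : IsPAIndex k f 0 := hPA.isPAIndex (by simp)
  have hy : IsPAIndex k f y := hPA.isPAIndex (by simp)
  have hy0 : 0 < y := lt_of_le_of_ne hy.1 (ne_of_card_pair hPA.card_eq_two)
  have hyk : y < k := hy.2.1
  have hmax : ∀ j, IsPAIndex k f j → j ≤ y := by
    obtain ⟨-, ⟨h, -⟩ | ⟨h, -⟩⟩ := nextPA_cases hy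
    · omega
    · exact h
  obtain ⟨hne, h2, -⟩ := hPA.pair_spec
  obtain ⟨ε, d, hS⟩ := isSplit_splitFun hy0 hyk hne h2
  have hiff := hS.isPAIndex_iff hW hPA hy0 hmax
  rcases hC' with ⟨E, rfl, rfl⟩ | ⟨-, hno, rfl, rfl⟩
  · generalize splitLen k f y = k' at *
    generalize splitFun k f y = f' at *
    by_cases hM : ∃ T ≤ E.l, ∀ j, IsPAIndex k' f' j → j ≤ E.idx T
    · obtain ⟨T, hT, hTmax⟩ := hM
      obtain ⟨E', hE'⟩ := exists_elemCycle_isRotated hS hA hmem hy0 hmax hiff E hT hTmax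
      exact ⟨ecFun E', Or.inl ⟨E', hE'.perm.length_eq, rfl⟩, listFun_isRotated hE'⟩
    · push Not at hM
      obtain ⟨E', hE'⟩ := exists_elemCycle_eq hS hyk hiff E hM
      refine ⟨ecFun E', Or.inl ⟨E', ?_, rfl⟩, 0, fun t => ?_⟩
      · rw [ecLen, ecLen, hE']
      · rw [ecFun, ecFun, hE', add_zero]
  · have hn0 : nextPA k f 0 = y := by
      refine nextPA_eq_of_lt h0 hy hy0 fun j hj hj0 => ?_
      by_contra hlt
      exact hno j ((hiff j).2 ⟨hj, hj0, not_le.1 hlt⟩)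
    let E : ElemCycle k f A :=
      { l := 0
        idx := fun _ => 0
        pa := fun _ _ => h0
        mem := fun t ht => absurd ht (Nat.not_lt_zero t)
        memLast := by rw [hn0, Finset.pair_comm]; exact hmem
        minimal := fun t h1 h2 => by omega
        canon := fun _ _ => rfl }
    have hE : ecOpenList E = splitList k f y := by
      simp [ecOpenList, ecSegment, E, hn0, splitList]
    exact ⟨ecFun E, Or.inl ⟨E, by rw [ecLen, hE, splitLen], rfl⟩, 0, fun t => by
      rw [ecFun, hE, add_zero, splitFun]⟩

end Hex
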